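/- arXiv:2309.08715 — 4 statements merged into one kernel-verified Lean document; each statement's English description precedes it below -/
import Mathlib

section
/- Let D be any byte pair dictionary, let φ₁,…,φₖ and φ'₁,…,φ'ₖ be tokenizations, and suppose φ₁⌢…⌢φₖ ⇒* φ'₁⌢…⌢φ'ₖ (where the concatenation of the blocks is taken as a single tokenization). If π(φᵢ) = π(φ'ᵢ) for every i ∈ {1,…,k}, then φᵢ ⇒* φ'ᵢ for every i ∈ {1,…,k}. -/
/-!
Formalization of byte pair encoding (BPE) tokenization semantics.

* The alphabet is a type `α`.
* A *token* is a (intended nonempty) string over `α`, i.e. a `List α`.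
* A *tokenization* is a finite sequence of tokens.
* A *byte pair dictionary* is a finite sequence of rules (pairs of tokens),
  listed in order of decreasing priority.
-/

/-- A token: a string over the alphabet `α`. -/
abbrev Token (α : Type*) := List α

/-- A tokenization: a finite sequence of tokens. -/
abbrev Tok (α : Type*) := List (Token α)

/-- A byte pair dictionary: a finite sequence of rules, in decreasing priority order. -/
abbrev Dict (α : Type*) := List (Token α × Token α)

variable {α : Type*}

/-- `π`: concatenation of the tokens of a tokenization. -/
def pi (τ : Tok α) : List α := τ.flatten

/-- All tokens of a tokenization are nonempty strings. -/
def NETok (τ : Tok α) : Prop := ∀ u ∈ τ, u ≠ []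

/-- All rules of a dictionary consist of nonempty tokens. -/
def NEDict (D : Dict α) : Prop := ∀ r ∈ D, r.1 ≠ [] ∧ r.2 ≠ []

/-- `Tk∅(w)`: the initial tokenization of `w` into single symbols. -/
def TkEmpty (w : List α) : Tok α := w.map (fun a => [a])

/-- Rule `r` applies in tokenization `τ` at position `p`
(i.e. `τ = φ ⌢ r.1 ⌢ r.2 ⌢ φ'` with `|φ| = p`). -/
def AppliesAt (r : Token α × Token α) (τ : Tok α) (p : ℕ) : Prop :=
  ∃ φ φ' : Tok α, φ.length = p ∧ τ = φ ++ r.1 :: r.2 :: φ'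

/-- Rule `r` applies somewhere in tokenization `τ`. -/
def Applies (r : Token α × Token α) (τ : Tok α) : Prop := ∃ p, AppliesAt r τ p

/-- The result of applying (merging by) rule `r` at position `p` in `τ`. -/
def applyAt (r : Token α × Token α) (τ : Tok α) (p : ℕ) : Tok α :=
  τ.take p ++ (r.1 ++ r.2) :: τ.drop (p + 2)

/-- The base (nondeterministic) rewriting step `τ ⇒ τ'`: some rule of `D`
is applied somewhere in `τ`. -/
def BStep (D : Dict α) (τ τ' : Tok α) : Prop :=
  ∃ (φ φ' : Tok α) (u v : Token α),
    (u, v) ∈ D ∧ τ = φ ++ u :: v :: φ' ∧ τ' = φ ++ (u ++ v) :: φ'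

/-- `τ` is a base tokenization of `w`: reachable from `Tk∅(w)` by base steps,
and no rule of `D` applies to it. -/
def IsBase (D : Dict α) (w : List α) (τ : Tok α) : Prop :=
  Relation.ReflTransGen (BStep D) (TkEmpty w) τ ∧ ∀ τ', ¬ BStep D τ τ'

/-- `BStepN D n τ τ'`: `τ'` is obtained from `τ` by exactly `n` base steps. -/
def BStepN (D : Dict α) : ℕ → Tok α → Tok α → Prop
  | 0 => Eq
  | n + 1 => fun τ τ'' => ∃ τ', BStepN D n τ τ' ∧ BStep D τ' τ''

/-- One SentencePiece step applying the rule of index `i` (highest priority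
applicable) at position `p` (leftmost occurrence of that rule). -/
def SPStepAt (D : Dict α) (i p : ℕ) (τ τ' : Tok α) : Prop :=
  ∃ h : i < D.length,
    AppliesAt (D[i]'h) τ p ∧
    (∀ (j : ℕ) (hj : j < D.length), j < i → ¬ Applies (D[j]'hj) τ) ∧
    (∀ q < p, ¬ AppliesAt (D[i]'h) τ q) ∧
    τ' = applyAt (D[i]'h) τ p

/-- One SentencePiece step: the highest priority applicable rule is applied
at its leftmost occurrence. -/
def SPStep (D : Dict α) (τ τ' : Tok α) : Prop := ∃ i p, SPStepAt D i p τ τ'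

/-- One SentencePiece step which applies the rule `r` of `D`. -/
def SPStepRule (D : Dict α) (r : Token α × Token α) (τ τ' : Tok α) : Prop :=
  ∃ (i p : ℕ) (h : i < D.length), D[i]'h = r ∧ SPStepAt D i p τ τ'

/-- `τ` is the SentencePiece tokenization `𝕋^D(w)` of `w`: reachable from
`Tk∅(w)` by SentencePiece steps, and no further step applies. -/
def IsSP (D : Dict α) (w : List α) (τ : Tok α) : Prop :=
  Relation.ReflTransGen (SPStep D) (TkEmpty w) τ ∧ ∀ τ', ¬ SPStep D τ τ'

/-- One application of rule `r` at its leftmost occurrence. -/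
def LeftStep (r : Token α × Token α) (τ τ' : Tok α) : Prop :=
  ∃ p, AppliesAt r τ p ∧ (∀ q < p, ¬ AppliesAt r τ q) ∧ τ' = applyAt r τ p

/-- Exhaustive application of rule `r`, leftmost first, until it no longer applies. -/
def Exhaust (r : Token α × Token α) (τ τ' : Tok α) : Prop :=
  Relation.ReflTransGen (LeftStep r) τ τ' ∧ ¬ Applies r τ'

/-- One HuggingFace (macro) step using the rule of index `i`: the rule of
index `i` is the highest-priority applicable rule, and it is applied
repeatedly at its leftmost occurrence until it no longer applies. -/
def HFStepAt (D : Dict α) (i : ℕ) (τ τ' : Tok α) : Prop :=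
  ∃ h : i < D.length,
    Applies (D[i]'h) τ ∧
    (∀ (j : ℕ) (hj : j < D.length), j < i → ¬ Applies (D[j]'hj) τ) ∧
    Exhaust (D[i]'h) τ τ'

/-- One HuggingFace (macro) step. -/
def HFStep (D : Dict α) (τ τ' : Tok α) : Prop := ∃ i, HFStepAt D i τ τ'

/-- One HuggingFace (macro) step which uses the rule `r` of `D`. -/
def HFStepRule (D : Dict α) (r : Token α × Token α) (τ τ' : Tok α) : Prop :=
  ∃ (i : ℕ) (h : i < D.length), D[i]'h = r ∧ HFStepAt D i τ τ'

/-- `τ` is the HuggingFace tokenization `𝕋_hf^D(w)` of `w`. -/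
def IsHF (D : Dict α) (w : List α) (τ : Tok α) : Prop :=
  Relation.ReflTransGen (HFStep D) (TkEmpty w) τ ∧ ∀ τ', ¬ HFStep D τ τ'

/-- A dictionary is *proper* if each side of each rule of length `> 1` is
produced by some higher-priority rule. -/
def Proper (D : Dict α) : Prop :=
  ∀ (j : ℕ) (hj : j < D.length),
    (1 < (D[j]'hj).1.length →
      ∃ (i : ℕ) (hi : i < D.length), i < j ∧ (D[j]'hj).1 = (D[i]'hi).1 ++ (D[i]'hi).2) ∧
    (1 < (D[j]'hj).2.length →
      ∃ (i : ℕ) (hi : i < D.length), i < j ∧ (D[j]'hj).2 = (D[i]'hi).1 ++ (D[i]'hi).2)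

/-- `max{|uv| : u⌢v ∈ D}`: the maximal total length of a rule of `D`. -/
def maxPairLen (D : Dict α) : ℕ := (D.map (fun r => (r.1 ++ r.2).length)).foldr max 0

/-- `l` is a sufficient lookahead bound for `D`: whenever `𝕋^D(π(φ)π(τ)) = φ⌢τ` with
`|π(τ)| ≥ l`, appending any further text keeps `φ` as a prefix of the tokenization. -/
def GoodLookahead (D : Dict α) (l : ℕ) : Prop :=
  ∀ φ τ ψ : Tok α, l ≤ (pi τ).length →
    IsSP D (pi φ ++ pi τ) (φ ++ τ) →
    ∃ ψ', IsSP D (pi φ ++ pi τ ++ pi ψ) (φ ++ ψ')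

/-- The lookahead constant `l(D)`: the smallest sufficient lookahead bound. -/
noncomputable def lookaheadConst (D : Dict α) : ℕ := sInf {l | GoodLookahead D l}

theorem BStep.pi_eq {D : Dict α} {τ τ' : Tok α} (h : BStep D τ τ') : pi τ = pi τ' := by
  obtain ⟨φ, φ', u, v, -, rfl, rfl⟩ := h
  simp [pi]

theorem pi_eq_of_reflTransGen {D : Dict α} {τ τ' : Tok α}
    (h : Relation.ReflTransGen (BStep D) τ τ') : pi τ = pi τ' := by
  induction h with
  | refl => rfl
  | tail _ hs ih => exact ih.trans hs.pi_eq

/-- A step into a concatenation takes place inside one of its two parts. -/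
theorem BStep.exists_append {D : Dict α} {τ x y : Tok α} (h : BStep D τ (x ++ y)) :
    ∃ x₀ y₀, τ = x₀ ++ y₀ ∧ (BStep D x₀ x ∧ y₀ = y ∨ x₀ = x ∧ BStep D y₀ y) := by
  obtain ⟨φ, φ', u, v, huv, rfl, heq⟩ := h
  rcases List.append_eq_append_iff.1 heq with ⟨c, rfl, rfl⟩ | ⟨a, rfl, h⟩
  · exact ⟨x, c ++ u :: v :: φ', by simp, .inr ⟨rfl, c, φ', u, v, huv, rfl, rfl⟩⟩
  · cases a with
    | nil =>
      exact ⟨φ, u :: v :: φ', rfl, .inr ⟨by simp, [], φ', u, v, huv, rfl, h.symm⟩⟩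
    | cons w a =>
      obtain ⟨rfl, rfl⟩ := List.cons.inj h
      exact ⟨φ ++ u :: v :: a, y, by simp, .inl ⟨⟨φ, a, u, v, huv, rfl, rfl⟩, rfl⟩⟩

/-- A derivation of a concatenation splits into derivations of its two parts. -/
theorem exists_append_of_reflTransGen {D : Dict α} {τ τ' : Tok α}
    (h : Relation.ReflTransGen (BStep D) τ τ') {x y : Tok α} (hxy : τ' = x ++ y) :
    ∃ x₀ y₀, τ = x₀ ++ y₀ ∧ Relation.ReflTransGen (BStep D) x₀ x ∧
      Relation.ReflTransGen (BStep D) y₀ y := by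
  induction h generalizing x y with
  | refl => exact ⟨x, y, hxy, .refl, .refl⟩
  | tail _ hs ih =>
    subst hxy
    obtain ⟨x₁, y₁, h₁, hstep⟩ := hs.exists_append
    obtain ⟨x₀, y₀, h₀, hx, hy⟩ := ih h₁
    rcases hstep with ⟨hx₁, rfl⟩ | ⟨rfl, hy₁⟩
    · exact ⟨x₀, y₀, h₀, hx.tail hx₁, hy⟩
    · exact ⟨x₀, y₀, h₀, hx, hy.tail hy₁⟩

theorem NETok.eq_nil_of_pi_eq_nil {τ : Tok α} (hτ : NETok τ) (h : pi τ = []) : τ = [] :=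
  List.eq_nil_iff_forall_not_mem.2 fun u hu => hτ u hu (List.flatten_eq_nil_iff.1 h u hu)

/-- Two initial segments of a tokenization that spell the same string coincide. -/
theorem append_inj_of_pi_eq {a b c d : Tok α} (ha : NETok a) (hc : NETok c)
    (h : a ++ b = c ++ d) (hpi : pi a = pi c) : a = c ∧ b = d := by
  suffices hac : a = c by
    subst hac
    exact ⟨rfl, List.append_cancel_left h⟩
  rcases List.append_eq_append_iff.1 h with ⟨e, rfl, -⟩ | ⟨e, rfl, -⟩
  · have he : e = [] := NETok.eq_nil_of_pi_eq_nil
      (fun u hu => hc u (List.mem_append_right _ hu)) (by simpa [pi] using hpi)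
    simp [he]
  · have he : e = [] := NETok.eq_nil_of_pi_eq_nil
      (fun u hu => ha u (List.mem_append_right _ hu)) (by simpa [pi] using hpi)
    simp [he]

/-- If `φ₁⌢…⌢φₖ ⇒* φ'₁⌢…⌢φ'ₖ` and `π(φᵢ) = π(φ'ᵢ)` for every `i`,
then `φᵢ ⇒* φ'ᵢ` for every `i`. -/
theorem blockwise_derivation (D : Dict α) (hD : NEDict D)
    (φs φs' : List (Tok α)) (hlen : φs.length = φs'.length)
    (hne : ∀ φ ∈ φs, NETok φ) (hne' : ∀ φ ∈ φs', NETok φ)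
    (hder : Relation.ReflTransGen (BStep D) φs.flatten φs'.flatten)
    (hpi : ∀ (i : ℕ) (h : i < φs.length), pi (φs[i]'h) = pi (φs'[i]'(hlen ▸ h))) :
    ∀ (i : ℕ) (h : i < φs.length),
      Relation.ReflTransGen (BStep D) (φs[i]'h) (φs'[i]'(hlen ▸ h)) := by
  induction φs generalizing φs' with
  | nil => exact fun i h => absurd h (Nat.not_lt_zero i)
  | cons a s ih =>
    cases φs' with
    | nil => simp at hlen
    | cons a' s' =>
      obtain ⟨x, y, hxy, hx, hy⟩ :=
        exists_append_of_reflTransGen hder (List.flatten_cons (l := a') (L := s'))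
      rw [List.flatten_cons] at hxy
      have hax : pi a = pi x :=
        (hpi 0 (Nat.succ_pos _)).trans (pi_eq_of_reflTransGen hx).symm
      have hnex : NETok x := fun u hu => by
        have hmem : u ∈ a ++ s.flatten := hxy ▸ List.mem_append_left y hu
        rw [← List.flatten_cons] at hmem
        obtain ⟨φ, hφ, huφ⟩ := List.mem_flatten.1 hmem
        exact hne φ hφ u huφ
      obtain ⟨rfl, rfl⟩ := append_inj_of_pi_eq (hne a List.mem_cons_self) hnex hxy hax
      have hrest := ih s' (Nat.succ.inj hlen)
        (fun φ hφ => hne φ (List.mem_cons_of_mem _ hφ))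
        (fun φ hφ => hne' φ (List.mem_cons_of_mem _ hφ)) hy
        (fun i h => hpi (i + 1) (Nat.succ_lt_succ h))
      intro i h
      cases i with
      | zero => exact hx
      | succ i => exact hrest i (Nat.lt_of_succ_lt_succ h)
end

section
/- Let D be a byte pair dictionary and w a string with 𝕋_hf^D(w) = τ₁⌢…⌢τₖ, where each τᵢ is a (contiguous, possibly multi-token) subtokenization of the whole tokenization. Then 𝕋_hf^D(π(τᵢ)) = τᵢ for every i ∈ {1,…,k}. -/
variable {α : Type*}

theorem AppliesAt.append_right {r : Token α × Token α} {σ : Tok α} {p : ℕ}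
    (h : AppliesAt r σ p) (ρ : Tok α) : AppliesAt r (σ ++ ρ) p := by
  obtain ⟨φ, φ', rfl, rfl⟩ := h
  exact ⟨φ, φ' ++ ρ, rfl, by simp⟩

theorem AppliesAt.append_left {r : Token α × Token α} {σ : Tok α} {p : ℕ}
    (h : AppliesAt r σ p) (ρ : Tok α) : AppliesAt r (ρ ++ σ) (ρ.length + p) := by
  obtain ⟨φ, φ', rfl, rfl⟩ := h
  exact ⟨ρ ++ φ, φ', by simp, by simp⟩

theorem Applies.append_right {r : Token α × Token α} {σ : Tok α}
    (h : Applies r σ) (ρ : Tok α) : Applies r (σ ++ ρ) :=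
  let ⟨_, hp⟩ := h
  ⟨_, hp.append_right ρ⟩

theorem Applies.append_left {r : Token α × Token α} {σ : Tok α}
    (h : Applies r σ) (ρ : Tok α) : Applies r (ρ ++ σ) :=
  let ⟨_, hp⟩ := h
  ⟨_, hp.append_left ρ⟩

theorem applyAt_length_append (r : Token α × Token α) (φ φ' : Tok α) :
    applyAt r (φ ++ r.1 :: r.2 :: φ') φ.length = φ ++ (r.1 ++ r.2) :: φ' := by
  simp [applyAt, List.drop_append]

/-- A leftmost step whose result is split into two parts acts inside one of them. -/
theorem LeftStep.split {r : Token α × Token α} {σ A B : Tok α} (h : LeftStep r σ (A ++ B)) :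
    ∃ A' B', σ = A' ++ B' ∧
      ((LeftStep r A' A ∧ B' = B) ∨ (A' = A ∧ LeftStep r B' B)) := by
  obtain ⟨_, ⟨φ, φ', rfl, rfl⟩, hleft, heq⟩ := h
  rw [applyAt_length_append] at heq
  rcases List.append_eq_append_iff.1 heq with ⟨C, rfl, rfl⟩ | ⟨C, rfl, hC⟩
  · refine ⟨A, C ++ r.1 :: r.2 :: φ', by simp, Or.inr ⟨rfl, C.length, ⟨C, φ', rfl, rfl⟩, ?_, ?_⟩⟩
    · intro q hq hr
      refine hleft (A.length + q) (by simpa using hq) ?_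
      simpa using hr.append_left A
    · rw [applyAt_length_append]
  · cases C with
    | nil =>
      obtain rfl : B = (r.1 ++ r.2) :: φ' := by simpa using hC.symm
      refine ⟨φ, r.1 :: r.2 :: φ', rfl,
        Or.inr ⟨by simp, 0, ⟨[], φ', rfl, rfl⟩, by simp, by simp [applyAt]⟩⟩
    | cons c C =>
      obtain ⟨rfl, rfl⟩ : r.1 ++ r.2 = c ∧ φ' = C ++ B := by simpa using hC
      refine ⟨φ ++ r.1 :: r.2 :: C, B, by simp,
        Or.inl ⟨⟨φ.length, ⟨φ, C, rfl, rfl⟩, ?_, ?_⟩, rfl⟩⟩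
      · intro q hq hr
        refine hleft q hq ?_
        simpa using hr.append_right B
      · rw [applyAt_length_append]

theorem Exhaust.split {r : Token α × Token α} {σ A B : Tok α} (h : Exhaust r σ (A ++ B)) :
    ∃ A' B', σ = A' ++ B' ∧ Exhaust r A' A ∧ Exhaust r B' B := by
  obtain ⟨hsteps, hend⟩ := h
  have hA : ¬ Applies r A := fun h => hend (h.append_right B)
  have hB : ¬ Applies r B := fun h => hend (h.append_left A)
  induction hsteps using Relation.ReflTransGen.head_induction_on with
  | refl => exact ⟨A, B, rfl, ⟨.refl, hA⟩, ⟨.refl, hB⟩⟩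
  | head hstep _ ih =>
    obtain ⟨A₁, B₁, rfl, hA₁, hB₁⟩ := ih
    obtain ⟨A', B', rfl, ⟨hA', rfl⟩ | ⟨rfl, hB'⟩⟩ := hstep.split
    · exact ⟨A', B', rfl, ⟨hA₁.1.head hA', hA⟩, hB₁⟩
    · exact ⟨A', B', rfl, hA₁, ⟨hB₁.1.head hB', hB⟩⟩

/-- Exhaustively applying `D[i]` is at most one HuggingFace step if no rule of higher
priority applies. -/
theorem Exhaust.reflTransGen_hfStep {D : Dict α} {i : ℕ} (hi : i < D.length) {σ τ : Tok α}
    (hprio : ∀ (j : ℕ) (hj : j < D.length), j < i → ¬ Applies (D[j]'hj) σ)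
    (h : Exhaust (D[i]'hi) σ τ) : Relation.ReflTransGen (HFStep D) σ τ := by
  by_cases happ : Applies (D[i]'hi) σ
  · exact .single ⟨i, hi, happ, hprio, h⟩
  · rcases h.1.cases_head with rfl | ⟨_, ⟨p, hp, _⟩, _⟩
    · exact .refl
    · exact absurd ⟨p, hp⟩ happ

theorem reflTransGen_hfStep_split {D : Dict α} {σ A B : Tok α}
    (h : Relation.ReflTransGen (HFStep D) σ (A ++ B)) :
    ∃ A' B', σ = A' ++ B' ∧ Relation.ReflTransGen (HFStep D) A' A ∧
      Relation.ReflTransGen (HFStep D) B' B := by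
  induction h using Relation.ReflTransGen.head_induction_on with
  | refl => exact ⟨A, B, rfl, .refl, .refl⟩
  | head hstep _ ih =>
    obtain ⟨A₁, B₁, rfl, hA₁, hB₁⟩ := ih
    obtain ⟨i, hi, _, hprio, hex⟩ := hstep
    obtain ⟨A', B', rfl, hA', hB'⟩ := hex.split
    exact ⟨A', B', rfl,
      (hA'.reflTransGen_hfStep hi fun j hj hji h => hprio j hj hji (h.append_right B')).trans hA₁,
      (hB'.reflTransGen_hfStep hi fun j hj hji h => hprio j hj hji (h.append_left A')).trans hB₁⟩

theorem LeftStep.pi_eq {r : Token α × Token α} {σ τ : Tok α} (h : LeftStep r σ τ) :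
    pi σ = pi τ := by
  obtain ⟨_, ⟨φ, φ', rfl, rfl⟩, _, rfl⟩ := h
  simp [applyAt_length_append, pi]

theorem Exhaust.pi_eq {r : Token α × Token α} {σ τ : Tok α} (h : Exhaust r σ τ) :
    pi σ = pi τ := by
  obtain ⟨hsteps, _⟩ := h
  clear * - hsteps
  induction hsteps with
  | refl => rfl
  | tail _ hleft ih => exact ih.trans hleft.pi_eq

theorem pi_eq_of_reflTransGen_hfStep {D : Dict α} {σ τ : Tok α}
    (h : Relation.ReflTransGen (HFStep D) σ τ) : pi σ = pi τ := by
  induction h with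
  | refl => rfl
  | tail _ hstep ih =>
    obtain ⟨_, _, _, _, hex⟩ := hstep
    exact ih.trans hex.pi_eq

theorem pi_tkEmpty (w : List α) : pi (TkEmpty w) = w := by
  induction w with
  | nil => rfl
  | cons a w ih => simpa [pi, TkEmpty] using ih

/-- Every rule can be applied exhaustively: each application shortens the tokenization. -/
theorem exists_exhaust (r : Token α × Token α) (σ : Tok α) : ∃ τ, Exhaust r σ τ := by
  classical
  induction hn : σ.length using Nat.strong_induction_on generalizing σ with
  | _ n ih =>
    by_cases happ : Applies r σ
    · have hstep : LeftStep r σ (applyAt r σ (Nat.find happ)) :=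
        ⟨_, Nat.find_spec happ, fun q hq => Nat.find_min happ hq, rfl⟩
      have hlen : (applyAt r σ (Nat.find happ)).length < n := by
        obtain ⟨φ, φ', hφ, hσ⟩ := Nat.find_spec happ
        rw [← hφ]
        subst hn
        rw [hσ, applyAt_length_append]
        simp
      obtain ⟨τ, hτ⟩ := ih _ hlen _ rfl
      exact ⟨τ, hτ.1.head hstep, hτ.2⟩
    · exact ⟨σ, .refl, happ⟩

/-- A tokenization is irreducible for HuggingFace steps iff no rule applies to it. -/
theorem forall_not_hfStep_iff {D : Dict α} {σ : Tok α} :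
    (∀ τ, ¬ HFStep D σ τ) ↔ ∀ (i : ℕ) (hi : i < D.length), ¬ Applies (D[i]'hi) σ := by
  constructor
  · intro h i
    induction i using Nat.strong_induction_on with
    | _ i ih =>
      intro hi happ
      obtain ⟨τ, hτ⟩ := exists_exhaust (D[i]'hi) σ
      exact h τ ⟨i, hi, happ, fun j hj hji => ih j hji hj, hτ⟩
  · rintro h τ ⟨i, hi, happ, _⟩
    exact h i hi happ

theorem IsHF.split {D : Dict α} {w : List α} {A B : Tok α} (h : IsHF D w (A ++ B)) :
    IsHF D (pi A) A ∧ IsHF D (pi B) B := by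
  obtain ⟨hsteps, hend⟩ := h
  rw [forall_not_hfStep_iff] at hend
  obtain ⟨A', B', hw, hA, hB⟩ := reflTransGen_hfStep_split hsteps
  obtain ⟨x, y, rfl, rfl, rfl⟩ := List.map_eq_append_iff.1 hw
  rw [← pi_eq_of_reflTransGen_hfStep hA, ← pi_eq_of_reflTransGen_hfStep hB]
  change IsHF D (pi (TkEmpty x)) A ∧ IsHF D (pi (TkEmpty y)) B
  rw [pi_tkEmpty, pi_tkEmpty]
  exact ⟨⟨hA, forall_not_hfStep_iff.2 fun i hi h => hend i hi (h.append_right B)⟩,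
    ⟨hB, forall_not_hfStep_iff.2 fun i hi h => hend i hi (h.append_left A)⟩⟩

/-- If `𝕋_hf^D(w) = τ₁⌢…⌢τₖ` (each `τᵢ` a contiguous block of tokens),
then `𝕋_hf^D(π(τᵢ)) = τᵢ` for every `i`. -/
theorem hf_of_block (D : Dict α) (hD : NEDict D) (w : List α)
    (τs : List (Tok α)) (h : IsHF D w τs.flatten) :
    ∀ (i : ℕ) (hi : i < τs.length), IsHF D (pi (τs[i]'hi)) (τs[i]'hi) := by
  induction τs generalizing w with
  | nil => simp
  | cons A τs ih =>
    rw [List.flatten_cons] at h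
    rintro (_ | i) hi
    · exact h.split.1
    · exact ih _ h.split.2 i (by simpa using hi)
end

section
/- Let D be a byte pair dictionary and u⌢v a rule of D. There exists a string w such that the rule u⌢v is applied at some step of the SentencePiece derivation producing 𝕋^D(w) if and only if u⌢v is applied at some step of the SentencePiece derivation producing 𝕋^D(uv). -/
variable {α : Type*}

/-- The rule `r` gets applied at some step of the SentencePiece derivation
producing `𝕋^D(w)`. -/
def SPUses (D : Dict α) (r : Token α × Token α) (w : List α) : Prop :=
  ∃ τ τ' : Tok α, Relation.ReflTransGen (SPStep D) (TkEmpty w) τ ∧ SPStepRule D r τ τ'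

/-- A rule applicable in a segment of a tokenization is applicable in the tokenization. -/
theorem Applies.append_append {r : Token α × Token α} {b : Tok α} (h : Applies r b) (a c : Tok α) :
    Applies r (a ++ b ++ c) := by
  obtain ⟨p, φ, φ', -, rfl⟩ := h
  exact ⟨(a ++ φ).length, a ++ φ, φ' ++ c, rfl, by simp⟩

/-- A SentencePiece step on `a ++ (φ ++ u :: v :: φ') ++ c` merging the displayed pair `u⌢v`
restricts to a SentencePiece step on `φ ++ u :: v :: φ'`. -/
theorem SPStepAt.restrict {D : Dict α} {i p : ℕ} {a φ φ' c τ' : Tok α} (hi : i < D.length)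
    (h : SPStepAt D i p (a ++ (φ ++ D[i].1 :: D[i].2 :: φ') ++ c) τ')
    (hp : p = (a ++ φ).length) :
    SPStepAt D i φ.length (φ ++ D[i].1 :: D[i].2 :: φ')
      (φ ++ (D[i].1 ++ D[i].2) :: φ') := by
  obtain ⟨_, -, hprio, hleft, -⟩ := h
  refine ⟨hi, ⟨φ, φ', rfl, rfl⟩, fun j hj hji h => hprio j hj hji (h.append_append a c), ?_, ?_⟩
  · rintro q hq ⟨ψ, ψ', rfl, he⟩
    refine hleft (a ++ ψ).length (by simp [hp, hq]) ⟨a ++ ψ, ψ' ++ c, rfl, ?_⟩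
    rw [he]; simp
  · simp [applyAt]

/-- A SentencePiece step acts on every contiguous segment of its result either trivially
or as a SentencePiece step. -/
theorem SPStep.segment {D : Dict α} {τ a b c : Tok α} (h : SPStep D τ (a ++ b ++ c)) :
    ∃ a' b' c', τ = a' ++ b' ++ c' ∧ pi b' = pi b ∧ (b' = b ∨ SPStep D b' b) := by
  obtain ⟨i, p, hs⟩ := h
  obtain ⟨hi, ⟨φ, φ', hp, rfl⟩, -, -, he⟩ := id hs
  have he : a ++ (b ++ c) = φ ++ (D[i].1 ++ D[i].2) :: φ' := by
    rw [← List.append_assoc, he]; simp [applyAt, ← hp]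
  rcases List.append_eq_append_iff.1 he with ⟨x, rfl, hx⟩ | ⟨x, rfl, hx⟩
  · rcases List.append_eq_append_iff.1 hx with ⟨y, rfl, hy⟩ | ⟨y, rfl, hy⟩
    · exact ⟨a, b, y ++ D[i].1 :: D[i].2 :: φ', by simp, rfl, .inl rfl⟩
    · rcases y with _ | ⟨t, y⟩
      · exact ⟨a, x, D[i].1 :: D[i].2 :: φ', by simp, by simp, .inl (by simp)⟩
      · obtain ⟨rfl, rfl⟩ := List.cons.inj hy
        refine ⟨a, x ++ D[i].1 :: D[i].2 :: y, c, by simp, by simp [pi], .inr ⟨i, x.length, ?_⟩⟩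
        exact SPStepAt.restrict (a := a) (c := c) hi (by simpa using hs) hp.symm
  · rcases x with _ | ⟨t, x⟩
    · rcases b with _ | ⟨t, b⟩
      · exact ⟨φ, [], D[i].1 :: D[i].2 :: φ', by simp, rfl, .inl rfl⟩
      · obtain ⟨rfl, rfl⟩ := List.cons.inj hx
        refine ⟨φ, D[i].1 :: D[i].2 :: b, c, by simp, by simp [pi], .inr ⟨i, 0, ?_⟩⟩
        exact SPStepAt.restrict (φ := []) (a := φ) (c := c) hi (by simpa using hs) (by simp [hp])
    · obtain ⟨-, rfl⟩ := List.cons.inj hx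
      exact ⟨φ ++ D[i].1 :: D[i].2 :: x, b, c, by simp, rfl, .inl rfl⟩

/-- Every contiguous segment of a tokenization reached from `Tk∅(w)` is itself reached
by the SentencePiece derivation of the string it spells. -/
theorem reflTransGen_spStep_segment {D : Dict α} {w : List α} {τ : Tok α}
    (h : Relation.ReflTransGen (SPStep D) (TkEmpty w) τ) {a b c : Tok α}
    (hτ : τ = a ++ b ++ c) :
    Relation.ReflTransGen (SPStep D) (TkEmpty (pi b)) b := by
  induction h generalizing a b c with
  | refl =>
    obtain ⟨w₁, w₂, -, h₁, -⟩ := List.map_eq_append_iff.1 hτ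
    obtain ⟨-, w₃, -, -, rfl⟩ := List.map_eq_append_iff.1 h₁
    have hpi : pi (w₃.map fun x => [x]) = w₃ := by
      simp [pi, ← List.flatMap_def]
    rw [hpi]
    exact .refl
  | tail _ hstep ih =>
    subst hτ
    obtain ⟨a', b', c', rfl, hpi, rfl | hb⟩ := hstep.segment
    · exact ih rfl
    · exact hpi ▸ (ih rfl).tail hb

/-- A rule `u⌢v` of `D` is applied in the SentencePiece derivation of
some string iff it is applied in the SentencePiece derivation of `uv`. -/
theorem sp_useful_iff (D : Dict α) (hD : NEDict D)
    (r : Token α × Token α) (hr : r ∈ D) :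
    (∃ w : List α, SPUses D r w) ↔ SPUses D r (r.1 ++ r.2) := by
  refine ⟨?_, fun h => ⟨_, h⟩⟩
  rintro ⟨w, τ, τ', hw, i, p, hi, rfl, hs⟩
  obtain ⟨_, ⟨φ, φ', hp, rfl⟩, -⟩ := id hs
  have hreach := reflTransGen_spStep_segment hw (a := φ) (b := [D[i].1, D[i].2]) (c := φ')
    (by simp)
  refine ⟨_, [D[i].1 ++ D[i].2], by simpa [pi] using hreach, i, 0, hi, rfl, ?_⟩
  exact SPStepAt.restrict (φ := []) (φ' := []) (a := φ) (c := φ') hi (by simpa using hs)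
    (by simp [hp])
end

section
/- Let D be a proper byte pair dictionary with |D| rules, and let φ and τ be tokenizations with |τ| ≥ |D| (τ consists of at least |D| tokens) and 𝕋^D(π(φ)π(τ)) = φ⌢τ. Then for every string v over Σ there exists a tokenization ψ' such that 𝕋^D(π(φ)π(τ)v) = φ⌢ψ'. In particular, the lookahead constant of D is at most |D|·max{|uv| : u⌢v ∈ D}. -/
variable {α : Type*}

namespace BPE

open Relation

/-- The SentencePiece step `X ⌢ u ⌢ v ⌢ Y → X ⌢ uv ⌢ Y` by the rule of index `i`. -/
structure Merge (D : Dict α) (i : ℕ) (X : Tok α) (u v : Token α) (Y s s' : Tok α) : Prop where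
  rule : D[i]? = some (u, v)
  source : s = X ++ u :: v :: Y
  target : s' = X ++ (u ++ v) :: Y
  highest : ∀ j < i, ∀ r, D[j]? = some r → ¬ Applies r s
  leftmost : ∀ q < X.length, ¬ AppliesAt (u, v) s q

/-- SentencePiece reachability. -/
abbrev Reach (D : Dict α) : Tok α → Tok α → Prop := ReflTransGen (SPStep D)

/-- `x` is a token boundary of `S`. -/
def Boundary (S : Tok α) (x : ℕ) : Prop := ∃ A B : Tok α, S = A ++ B ∧ (pi A).length = x

/-- After `S`, rule `i` only merges at boundaries that are not to the left of `b`. -/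
def Blocked (D : Dict α) (i b : ℕ) (S : Tok α) : Prop :=
  ∀ S' S'' P u v Q, Reach D S S' → Merge D i P u v Q S' S'' → b ≤ (pi P).length + u.length

variable {D : Dict α} {i : ℕ} {X Y s s' : Tok α} {u v : Token α}

@[simp] lemma pi_append (A B : Tok α) : pi (A ++ B) = pi A ++ pi B := by simp [pi]

@[simp] lemma pi_cons (t : Token α) (A : Tok α) : pi (t :: A) = t ++ pi A := by simp [pi]

@[simp] lemma pi_nil : pi ([] : Tok α) = [] := by simp [pi]

@[simp] lemma pi_TkEmpty (w : List α) : pi (TkEmpty w) = w := by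
  induction w with
  | nil => rfl
  | cons a w ih => simpa [TkEmpty] using ih

lemma TkEmpty_eq_append {w : List α} {A B : Tok α} (h : TkEmpty w = A ++ B) :
    A = TkEmpty (pi A) ∧ B = TkEmpty (pi B) := by
  obtain ⟨a, b, rfl, rfl, rfl⟩ := List.map_eq_append_iff.1 h
  exact ⟨congrArg TkEmpty (pi_TkEmpty a).symm, congrArg TkEmpty (pi_TkEmpty b).symm⟩

lemma _root_.AppliesAt.append_right_s10 {r : Token α × Token α} {p : ℕ} (h : AppliesAt r s p)
    (B : Tok α) :
    AppliesAt r (s ++ B) p := by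
  obtain ⟨X, Y, hX, rfl⟩ := h
  exact ⟨X, Y ++ B, hX, by simp⟩

lemma _root_.AppliesAt.append_left_s10 {r : Token α × Token α} {p : ℕ} (h : AppliesAt r s p)
    (A : Tok α) :
    AppliesAt r (A ++ s) (A.length + p) := by
  obtain ⟨X, Y, rfl, rfl⟩ := h
  exact ⟨A ++ X, Y, by simp, by simp⟩

lemma Merge.spStep (h : Merge D i X u v Y s s') : SPStep D s s' := by
  obtain ⟨hi, hr⟩ := List.getElem?_eq_some_iff.1 h.rule
  refine ⟨i, X.length, hi, ?_, fun j hj hji => h.highest j hji _ (by simp [hj]), ?_, ?_⟩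
  · rw [hr]
    exact ⟨X, Y, rfl, h.source⟩
  · rw [hr]
    exact h.leftmost
  · rw [hr, h.source, h.target]
    simp [applyAt, List.drop_append]

lemma _root_.SPStep.exists_merge (h : SPStep D s s') : ∃ i X u v Y, Merge D i X u v Y s s' := by
  obtain ⟨i, p, hi, ⟨X, Y, rfl, rfl⟩, hj, hq, rfl⟩ := h
  refine ⟨i, X, D[i].1, D[i].2, Y, by simp [hi], rfl, ?_, ?_, hq⟩
  · simp [applyAt, List.drop_append]
  · intro j hji r hr
    obtain ⟨h', rfl⟩ := List.getElem?_eq_some_iff.1 hr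
    exact hj j h' hji

lemma _root_.SPStep.deterministic {a b : Tok α} (ha : SPStep D s a) (hb : SPStep D s b) :
    a = b := by
  obtain ⟨i, p, hi, ha₁, ha₂, ha₃, rfl⟩ := ha
  obtain ⟨j, q, hj, hb₁, hb₂, hb₃, rfl⟩ := hb
  obtain hij | rfl | hij := lt_trichotomy i j
  · exact absurd ⟨p, ha₁⟩ (hb₂ i hi hij)
  · obtain hpq | rfl | hpq := lt_trichotomy p q
    · exact absurd ha₁ (hb₃ p hpq)
    · rfl
    · exact absurd hb₁ (ha₃ q hpq)
  · exact absurd ⟨q, hb₁⟩ (ha₂ j hj hij)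

lemma exists_spStep {r : Token α × Token α} (hr : r ∈ D) (h : Applies r s) :
    ∃ s', SPStep D s s' := by
  classical
  have hex : ∃ i, ∃ h : i < D.length, Applies D[i] s := by
    obtain ⟨i, hi, rfl⟩ := List.getElem_of_mem hr
    exact ⟨i, hi, h⟩
  obtain ⟨hi, hp⟩ := Nat.find_spec hex
  exact ⟨_, Nat.find hex, Nat.find hp, hi, Nat.find_spec hp,
    fun j hj hji hA => Nat.find_min hex hji ⟨hj, hA⟩, fun q hq => Nat.find_min hp hq, rfl⟩

lemma _root_.SPStep.applies (h : SPStep D s s') : ∃ r ∈ D, Applies r s := by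
  obtain ⟨i, p, hi, hA, -⟩ := h
  exact ⟨_, List.getElem_mem hi, p, hA⟩

lemma _root_.SPStep.length_lt (h : SPStep D s s') : s'.length < s.length := by
  obtain ⟨i, X, u, v, Y, h⟩ := h.exists_merge
  simp [h.source, h.target]

lemma _root_.SPStep.pi_eq (h : SPStep D s s') : pi s' = pi s := by
  obtain ⟨i, X, u, v, Y, h⟩ := h.exists_merge
  simp [h.source, h.target]

lemma Reach.pi_eq (h : Reach D s s') : pi s' = pi s := by
  induction h with
  | refl => rfl
  | tail _ h ih => rw [h.pi_eq, ih]

lemma Reach.length_le (h : Reach D s s') : s'.length ≤ s.length := by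
  induction h with
  | refl => rfl
  | tail _ h ih => exact h.length_lt.le.trans ih

lemma exists_normalForm (D : Dict α) (s : Tok α) : ∃ N, Reach D s N ∧ ∀ τ, ¬ SPStep D N τ := by
  induction hn : s.length using Nat.strong_induction_on generalizing s with
  | _ n ih =>
    subst hn
    by_cases h : ∃ s', SPStep D s s'
    · obtain ⟨s', h⟩ := h
      obtain ⟨N, hN, hN'⟩ := ih _ h.length_lt s' rfl
      exact ⟨N, .head h hN, hN'⟩
    · exact ⟨s, .refl, by simpa using h⟩

lemma exists_isSP (D : Dict α) (w : List α) : ∃ N, IsSP D w N := exists_normalForm D (TkEmpty w)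

/-- Reaching a normal form: every reachable state leads to it. -/
lemma Reach.reach_normalForm {N : Tok α} (h : Reach D s s') (hN : Reach D s N)
    (hN' : ∀ τ, ¬ SPStep D N τ) : Reach D s' N := by
  induction h with
  | refl => exact hN
  | tail _ h ih =>
    obtain rfl | ⟨c, hc, hcN⟩ := ih.cases_head
    · exact absurd h (hN' _)
    · rwa [h.deterministic hc]

lemma _root_.IsSP.unique {w : List α} {N N' : Tok α} (h : IsSP D w N) (h' : IsSP D w N') :
    N = N' := by
  obtain rfl | ⟨c, hc, -⟩ := (Reach.reach_normalForm h.1 h'.1 h'.2).cases_head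
  · rfl
  · exact absurd hc (h.2 _)

/-- A merge whose result is split as `A ⌢ B` happens inside one of the two parts. -/
lemma Merge.split {A B : Tok α} (h : Merge D i X u v Y s (A ++ B)) :
    (∃ Y₁, Y = Y₁ ++ B ∧ s = (X ++ u :: v :: Y₁) ++ B ∧
      Merge D i X u v Y₁ (X ++ u :: v :: Y₁) A) ∨
    (∃ X₁, X = A ++ X₁ ∧ s = A ++ (X₁ ++ u :: v :: Y) ∧
      Merge D i X₁ u v Y (X₁ ++ u :: v :: Y) B) := by
  obtain ⟨hr, rfl, ht, hj, hq⟩ := h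
  have right : ∀ X₁, X = A ++ X₁ → B = X₁ ++ (u ++ v) :: Y →
      ∃ X₁, X = A ++ X₁ ∧ X ++ u :: v :: Y = A ++ (X₁ ++ u :: v :: Y) ∧
        Merge D i X₁ u v Y (X₁ ++ u :: v :: Y) B := by
    rintro X₁ rfl rfl
    refine ⟨X₁, rfl, by simp, hr, rfl, rfl, fun j hji r hr ⟨p, hp⟩ => ?_, fun q hqX hA => ?_⟩
    · exact hj j hji r hr ⟨_, by simpa using hp.append_left_s10 A⟩
    · exact hq (A.length + q) (by simpa using hqX) (by simpa using hA.append_left_s10 A)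
  obtain ⟨X₁, hX, hB⟩ | ⟨A₁, rfl, hA⟩ := List.append_eq_append_iff.1 ht
  · exact .inr (right X₁ hX hB)
  · rcases A₁ with - | ⟨a, Y₁⟩
    · exact .inr (right [] (by simp) (by simpa using hA.symm))
    · obtain ⟨rfl, rfl⟩ : u ++ v = a ∧ Y = Y₁ ++ B := by simpa using hA
      refine .inl ⟨Y₁, rfl, by simp, hr, rfl, rfl, fun j hji r hr ⟨p, hp⟩ => ?_,
        fun q hqX hA => ?_⟩
      · exact hj j hji r hr ⟨p, by simpa using hp.append_right_s10 B⟩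
      · exact hq q hqX (by simpa using hA.append_right_s10 B)

lemma _root_.SPStep.split {A B : Tok α} (h : SPStep D s (A ++ B)) :
    ∃ A₀ B₀, s = A₀ ++ B₀ ∧ Reach D A₀ A ∧ Reach D B₀ B := by
  obtain ⟨i, X, u, v, Y, h⟩ := h.exists_merge
  obtain ⟨Y₁, -, hs, h⟩ | ⟨X₁, -, hs, h⟩ := h.split
  · exact ⟨_, _, hs, .single h.spStep, .refl⟩
  · exact ⟨_, _, hs, .refl, .single h.spStep⟩

/-- A run ending in `A ⌢ B` restricts to runs on the two parts. -/
lemma Reach.split {A B : Tok α} (h : Reach D s (A ++ B)) :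
    ∃ A₀ B₀, s = A₀ ++ B₀ ∧ Reach D A₀ A ∧ Reach D B₀ B := by
  induction h using ReflTransGen.head_induction_on with
  | refl => exact ⟨A, B, rfl, .refl, .refl⟩
  | head h _ ih =>
    obtain ⟨A₁, B₁, rfl, hA, hB⟩ := ih
    obtain ⟨A₀, B₀, hs, hA', hB'⟩ := h.split
    exact ⟨A₀, B₀, hs, hA'.trans hA, hB'.trans hB⟩

lemma Reach.restrict_left {w : List α} {A B : Tok α} (h : Reach D (TkEmpty w) (A ++ B)) :
    Reach D (TkEmpty (pi A)) A := by
  obtain ⟨A₀, B₀, hs, hA, -⟩ := h.split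
  rwa [hA.pi_eq, ← (TkEmpty_eq_append hs).1]

lemma _root_.IsSP.restrict_left {w : List α} {A B : Tok α} (h : IsSP D w (A ++ B)) :
    IsSP D (pi A) A := by
  refine ⟨Reach.restrict_left h.1, fun τ hτ => ?_⟩
  obtain ⟨r, hr, p, hp⟩ := hτ.applies
  obtain ⟨s', hs'⟩ := exists_spStep hr ⟨p, hp.append_right_s10 B⟩
  exact h.2 _ hs'

/-- Of two aligned occurrences of the same string, the left one is tokenized ahead of the
right one. -/
lemma Reach.left_ahead {w : List α} {S X Y M Y' Z : Tok α} (h : Reach D (TkEmpty w) S)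
    (hS : S = X ++ (Y ++ (M ++ (Y' ++ Z)))) (hY : pi Y = pi Y') : Reach D Y' Y := by
  induction h generalizing X Y M Y' Z with
  | refl =>
    obtain ⟨-, h⟩ := TkEmpty_eq_append hS
    obtain ⟨h₁, h⟩ := TkEmpty_eq_append h.symm
    obtain ⟨-, h⟩ := TkEmpty_eq_append h.symm
    obtain ⟨h₂, -⟩ := TkEmpty_eq_append h.symm
    rw [h₁, h₂, hY]
  | tail _ hst ih =>
    subst hS
    obtain ⟨i, P, u, v, Q, h⟩ := hst.exists_merge
    obtain ⟨_, -, hs, h₁⟩ | ⟨P₁, hP₁, hs, h₁⟩ := h.split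
    · exact ih hs hY
    obtain ⟨_, -, hs₂, h₂⟩ | ⟨P₂, hP₂, hs₂, h₂⟩ := h₁.split
    · rw [hs₂] at hs
      exact (ih hs (h₂.spStep.pi_eq.symm.trans hY)).tail h₂.spStep
    rw [hs₂] at hs
    obtain ⟨_, -, hs₃, h₃⟩ | ⟨P₃, hP₃, hs₃, h₃⟩ := h₂.split
    · rw [hs₃] at hs
      exact ih hs hY
    rw [hs₃] at hs
    obtain ⟨Q₄, -, hs₄, h₄⟩ | ⟨P₄, hP₄, hs₄, h₄⟩ := h₃.split
    · rw [hs₄] at hs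
      obtain hc | ⟨c, hc, hcY⟩ := (ih hs (hY.trans h₄.spStep.pi_eq)).cases_head
      · refine absurd ?_ (h.leftmost (X.length + P₃.length) ?_)
        · exact ⟨X ++ P₃, Q₄ ++ (M ++ ((P₃ ++ u :: v :: Q₄) ++ Z)), by simp, by simp [hs, ← hc]⟩
        · simp [hP₁, hP₂, hP₃, ← hc]
      · rwa [h₄.spStep.deterministic hc]
    · rw [hs₄] at hs
      exact ih hs hY

lemma Reach.nonempty (hD : NEDict D) {w : List α} (h : Reach D (TkEmpty w) s) : NETok s := by
  induction h with
  | refl => simp [NETok, TkEmpty]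
  | tail _ h ih =>
    obtain ⟨i, X, u, v, Y, h⟩ := h.exists_merge
    have hu := (hD _ (List.mem_of_getElem? h.rule)).1
    intro t ht
    rw [h.target] at ht
    rw [h.source] at ih
    simp only [List.mem_append, List.mem_cons] at ht
    obtain ht | rfl | ht := ht
    · exact ih t (by simp [ht])
    · simp [hu]
    · exact ih t (by simp [ht])

lemma length_le_maxPairLen {r : Token α × Token α} (hr : r ∈ D) :
    r.1.length + r.2.length ≤ maxPairLen D := by
  induction D with
  | nil => simp at hr
  | cons a D ih =>
    simp only [maxPairLen, List.map_cons, List.foldr_cons, List.length_append] at ih ⊢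
    obtain rfl | hr := List.mem_cons.1 hr
    · exact le_max_left _ _
    · exact (ih hr).trans (le_max_right _ _)

lemma Reach.token_length_le {w : List α} (h : Reach D (TkEmpty w) s) :
    ∀ t ∈ s, t.length ≤ max 1 (maxPairLen D) := by
  induction h with
  | refl => simp [TkEmpty]
  | tail _ h ih =>
    obtain ⟨i, X, u, v, Y, h⟩ := h.exists_merge
    have huv : u.length + v.length ≤ maxPairLen D :=
      length_le_maxPairLen (List.mem_of_getElem? h.rule)
    intro t ht
    rw [h.target] at ht
    rw [h.source] at ih
    simp only [List.mem_append, List.mem_cons] at ht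
    obtain ht | rfl | ht := ht
    · exact ih t (by simp [ht])
    · simp only [List.length_append]
      omega
    · exact ih t (by simp [ht])

lemma length_pi_le {l : ℕ} {A : Tok α} (h : ∀ t ∈ A, t.length ≤ l) :
    (pi A).length ≤ A.length * l := by
  induction A with
  | nil => simp
  | cons t A ih =>
    have := ih fun t ht => h t (by simp [ht])
    have := h t (by simp)
    simp only [pi_cons, List.length_append, List.length_cons]
    linarith

lemma Blocked.step {b : ℕ} (hb : Blocked D i b s) (h : SPStep D s s') : Blocked D i b s' :=
  fun S' S'' P u v Q hS => hb S' S'' P u v Q (.head h hS)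

/-- Once rule `i` has been applied, it is never applied further to the left. -/
lemma Merge.blocked (hD : NEDict D) {w : List α} (hs : Reach D (TkEmpty w) s)
    (h : Merge D i X u v Y s s') : Blocked D i ((pi X).length + u.length) s' := by
  intro S' S'' P u' v' Q hS hm
  obtain ⟨rfl, rfl⟩ : u = u' ∧ v = v' := by simpa [h.rule] using hm.rule
  obtain ⟨hu, hv⟩ := hD _ (List.mem_of_getElem? h.rule)
  have hs' : Reach D (TkEmpty w) s' := .tail hs h.spStep
  by_contra! hlt
  have hsrc : S' = P ++ ([u, v] ++ Q) := by simp [hm.source]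
  rw [hsrc] at hS
  obtain ⟨A, C, hAC, hA, hC⟩ := hS.split
  obtain ⟨B, E, rfl, hB, -⟩ := Reach.split hC
  have hpB : pi B = u ++ v := by simpa using hB.pi_eq.symm
  have hpA := hA.pi_eq
  have hBlen : 2 ≤ B.length := by simpa using hB.length_le
  have ht := h.target
  rw [hAC, ← List.append_assoc] at ht
  have left : ∀ M, X = A ++ B ++ M → False := by
    rintro M rfl
    have hr : Reach D [u ++ v] B := hs'.left_ahead (X := A) (M := M) (Z := Y)
      (by simp [h.target]) (by simp [hpB])
    have := hr.length_le
    simp at this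
    omega
  obtain ⟨M, hM, -⟩ | ⟨M, hM, hM'⟩ := List.append_eq_append_iff.1 ht
  · exact left M hM
  · rcases M with - | ⟨a, M⟩
    · exact left [] (by simpa using hM.symm)
    · obtain ⟨rfl, -⟩ : u ++ v = a ∧ Y = M ++ E := by simpa using hM'
      have := congrArg (fun T => (pi T).length) hM
      simp only [pi_append, pi_cons, List.length_append, hpB, ← hpA] at this hlt
      omega

lemma boundary_TkEmpty (w w' : List α) : Boundary (TkEmpty (w ++ w')) w.length :=
  ⟨TkEmpty w, TkEmpty w', by simp [TkEmpty], by simp⟩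

/-- A merge removes only the boundary between the two merged tokens. -/
lemma Merge.boundary {x : ℕ} (h : Merge D i X u v Y s s') (hx : Boundary s x) :
    x = (pi X).length + u.length ∨ Boundary s' x := by
  obtain ⟨A, B, hAB, rfl⟩ := hx
  have hs := h.source
  rw [hAB] at hs
  obtain ⟨M, rfl, -⟩ | ⟨M, rfl, hM⟩ := List.append_eq_append_iff.1 hs
  · exact .inr ⟨A, M ++ (u ++ v) :: Y, by simp [h.target], rfl⟩
  · rcases M with - | ⟨a, - | ⟨b, M⟩⟩
    · exact .inr ⟨X, (u ++ v) :: Y, h.target, by simp⟩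
    · obtain ⟨rfl, -⟩ := List.cons_eq_cons.1 hM
      exact .inl (by simp)
    · obtain ⟨rfl, rfl, rfl⟩ : u = a ∧ v = b ∧ Y = M ++ B := by simpa using hM
      exact .inr ⟨X ++ (u ++ v) :: M, B, by simp [h.target], by simp⟩

lemma Boundary.exists_restrict_left {w w' : List α} (h : Boundary s w.length)
    (hs : pi s = w ++ w') :
    ∃ A B, s = A ++ B ∧ pi A = w := by
  obtain ⟨A, B, rfl, hA⟩ := h
  exact ⟨A, B, rfl, (List.append_inj (by simpa using hs) hA).1⟩

/-- If the boundary after `φ ⌢ t` is still present, then so is the boundary after `φ`. -/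
lemma Boundary.of_snoc {φ : Tok α} {t : Token α} {w : List α}
    (hsp : IsSP D (pi (φ ++ [t])) (φ ++ [t])) (hs : Reach D (TkEmpty (pi (φ ++ [t]) ++ w)) s)
    (h : Boundary s (pi (φ ++ [t])).length) : Boundary s (pi φ).length := by
  obtain ⟨A, B, rfl, hA⟩ := h.exists_restrict_left (hs.pi_eq.trans (pi_TkEmpty _))
  have hr : Reach D A (φ ++ [t]) := by
    have := hs.restrict_left
    rw [hA] at this
    exact this.reach_normalForm hsp.1 hsp.2
  obtain ⟨A₁, A₂, rfl, hA₁, -⟩ := hr.split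
  exact ⟨A₁, A₂ ++ B, by simp, by rw [hA₁.pi_eq]⟩

/-- Removing the boundary between `φ` and `τ` uses up `|τ| + 1` rules. -/
lemma Reach.boundary_or_blocked (hD : NEDict D) {φ τ : Tok α}
    (hsp : IsSP D (pi (φ ++ τ)) (φ ++ τ)) (w : List α) {S : Tok α}
    (hS : Reach D (TkEmpty (pi (φ ++ τ) ++ w)) S) :
    Boundary S (pi φ).length ∨ ∃ I ⊆ Finset.range D.length, I.card = τ.length + 1 ∧
      ∀ i ∈ I, Blocked D i (pi φ).length S := by
  induction τ generalizing φ S with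
  | nil =>
    simp only [List.append_nil] at hS
    induction hS with
    | refl => exact .inl (boundary_TkEmpty _ _)
    | tail hr hst ih =>
      obtain hb | ⟨I, hI, hc, hbl⟩ := ih
      · obtain ⟨i, X, u, v, Y, hm⟩ := hst.exists_merge
        obtain hx | hb := hm.boundary hb
        · refine .inr ⟨{i}, ?_, by simp, ?_⟩
          · simpa using (List.getElem?_eq_some_iff.1 hm.rule).1
          · simpa [hx] using hm.blocked hD hr
        · exact .inl hb
      · exact .inr ⟨I, hI, hc, fun i hi => (hbl i hi).step hst⟩
  | cons t τ ihτ =>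
    have e : φ ++ t :: τ = φ ++ [t] ++ τ := by simp
    rw [e] at hsp hS
    have ht : t ≠ [] := Reach.nonempty hD hsp.1 t (by simp)
    induction hS with
    | refl =>
      left
      simpa using boundary_TkEmpty (pi φ) (t ++ (pi τ ++ w))
    | tail hr hst ih =>
      obtain hb | ⟨I, hI, hc, hbl⟩ := ih
      · obtain ⟨i, X, u, v, Y, hm⟩ := hst.exists_merge
        obtain hx | hb := hm.boundary hb
        · have hlt : (pi φ).length < (pi (φ ++ [t])).length := by
            simpa using List.length_pos_iff.2 ht
          obtain hb' | ⟨I, hI, hc, hbl⟩ := ihτ hsp hr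
          · obtain hx' | hb' := hm.boundary hb'
            · omega
            · refine .inl (hb'.of_snoc (w := pi τ ++ w) (IsSP.restrict_left hsp) ?_)
              rw [← List.append_assoc, ← pi_append]
              exact hr.tail hst
          · have hi : i ∉ I := fun hi => by
              have := hbl i hi _ _ _ _ _ _ .refl hm
              omega
            refine .inr ⟨I.cons i hi, ?_,
              by rw [Finset.card_cons, hc, List.length_cons], fun j hj => ?_⟩
            · intro j hj
              obtain rfl | hj := Finset.mem_cons.1 hj
              · simpa using (List.getElem?_eq_some_iff.1 hm.rule).1
              · exact hI hj
            · obtain rfl | hj := Finset.mem_cons.1 hj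
              · rw [hx]
                exact hm.blocked hD hr
              · exact fun _ _ _ _ _ _ h₁ h₂ =>
                  hlt.le.trans ((hbl j hj).step hst _ _ _ _ _ _ h₁ h₂)
        · exact .inl hb
      · exact .inr ⟨I, hI, hc, fun i hi => (hbl i hi).step hst⟩

lemma _root_.IsSP.extend (hD : NEDict D) {φ τ : Tok α} (hlen : D.length ≤ τ.length)
    (hsp : IsSP D (pi φ ++ pi τ) (φ ++ τ)) (w : List α) :
    ∃ ψ, IsSP D (pi φ ++ pi τ ++ w) (φ ++ ψ) := by
  obtain ⟨N, hN⟩ := exists_isSP D (pi φ ++ pi τ ++ w)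
  rw [← pi_append] at hsp hN
  obtain hb | ⟨I, hI, hc, -⟩ := Reach.boundary_or_blocked hD hsp w hN.1
  · obtain ⟨A, B, rfl, hA⟩ := hb.exists_restrict_left (w' := pi τ ++ w)
      (by simpa using Reach.pi_eq hN.1)
    have hA' := IsSP.restrict_left hN
    rw [hA] at hA'
    obtain rfl := IsSP.unique hA' (IsSP.restrict_left hsp)
    exact ⟨B, by simpa using hN⟩
  · have := Finset.card_le_card hI
    simp at this
    omega

lemma goodLookahead (hD : NEDict D) : GoodLookahead D (D.length * maxPairLen D) := by
  intro φ τ ψ hl hsp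
  refine IsSP.extend hD ?_ hsp _
  rcases D with - | ⟨r, D⟩
  · simp
  · have hmax : 1 ≤ maxPairLen (r :: D) :=
      (List.length_pos_iff.2 (hD r (by simp)).1).trans_le
        ((Nat.le_add_right _ _).trans (length_le_maxPairLen (by simp)))
    have hτ : (pi τ).length ≤ τ.length * maxPairLen (r :: D) := length_pi_le fun t ht => by
      simpa [hmax] using Reach.token_length_le hsp.1 t (by simp [ht])
    exact Nat.le_of_mul_le_mul_right (hl.trans hτ) hmax

end BPE

/-- If `D` is proper, `|τ| ≥ |D|` and `𝕋^D(π(φ)π(τ)) = φ⌢τ`, then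
for every string `v` there is `ψ'` with `𝕋^D(π(φ)π(τ)v) = φ⌢ψ'`; in particular
`l(D) ≤ |D|·max{|uv| : u⌢v ∈ D}`. -/
theorem lookahead_bound (D : Dict α) (hD : NEDict D) (hP : Proper D)
    (φ τ : Tok α) (hlen : D.length ≤ τ.length)
    (hsp : IsSP D (pi φ ++ pi τ) (φ ++ τ)) :
    (∀ v : List α, ∃ ψ' : Tok α, IsSP D (pi φ ++ pi τ ++ v) (φ ++ ψ')) ∧
      lookaheadConst D ≤ D.length * maxPairLen D := by
  exact ⟨IsSP.extend hD hlen hsp, Nat.sInf_le (BPE.goodLookahead hD)⟩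
end
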